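/- Let R be a TRS such that R ∪ P is an overlay system, let ℓ → r be a rule of P, and let δ'' be a substitution such that xδ'' is a normal form of R for every variable x ∈ Var(ℓ). Then every proper subterm of ℓδ'' is a normal form of R. -/

import Mathlib

namespace RWS

/-- First-order terms over a signature `F` (function symbols of arbitrary arity,
realized by lists of arguments) and variables `V`. -/
inductive Term (F V : Type) : Type
  | var : V → Term F V
  | app : F → List (Term F V) → Term F V

namespace Term

variable {F V : Type}

/-- `t` is a variable. -/
def IsVar : Term F V → Prop
  | var _ => True
  | app _ _ => False

/-- Application of a substitution (a map from variables to terms) to a term. -/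
def subst (σ : V → Term F V) : Term F V → Term F V
  | var x => σ x
  | app f ts => app f (ts.attach.map fun t => t.1.subst σ)
decreasing_by
  simp_wf
  have := List.sizeOf_lt_of_mem t.2
  omega

/-- The list of variable occurrences of a term. -/
def varOccs : Term F V → List V
  | var x => [x]
  | app _ ts => (ts.attach.map fun t => t.1.varOccs).flatten
decreasing_by
  simp_wf
  have := List.sizeOf_lt_of_mem t.2
  omega

/-- A term is linear if no variable occurs in it more than once. -/
def Linear (t : Term F V) : Prop := t.varOccs.Nodup

end Term

variable {F V : Type}

/-- `PSub t u` : `t` is a proper subterm of `u` (i.e. `u ▷ t`). -/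
inductive PSub : Term F V → Term F V → Prop
  | head {t f ts} : t ∈ ts → PSub t (.app f ts)
  | tail {t u f ts} : PSub t u → u ∈ ts → PSub t (.app f ts)

/-- Subterm-or-equal relation. -/
def Sub (t u : Term F V) : Prop := t = u ∨ PSub t u

/-- The rewrite relation of a set `R` of rewrite rules: contraction of a redex
at some position (root rule instance, closed under contexts). -/
inductive Rew (R : Set (Term F V × Term F V)) : Term F V → Term F V → Prop
  | root {l r : Term F V} {σ : V → Term F V} :
      (l, r) ∈ R → Rew R (l.subst σ) (r.subst σ)
  | congr {s t : Term F V} {f : F} {ts us : List (Term F V)} :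
      Rew R s t → Rew R (.app f (ts ++ s :: us)) (.app f (ts ++ t :: us))

/-- `t` is a normal form of `R`. -/
def NormalForm (R : Set (Term F V × Term F V)) (t : Term F V) : Prop :=
  ∀ u, ¬ Rew R t u

/-- Innermost rewriting: contraction of a redex all of whose proper subterms
are normal forms of `R`. -/
inductive IRew (R : Set (Term F V × Term F V)) : Term F V → Term F V → Prop
  | root {l r : Term F V} {σ : V → Term F V} :
      (l, r) ∈ R → (∀ u, PSub u (l.subst σ) → NormalForm R u) →
      IRew R (l.subst σ) (r.subst σ)
  | congr {s t : Term F V} {f : F} {ts us : List (Term F V)} :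
      IRew R s t → IRew R (.app f (ts ++ s :: us)) (.app f (ts ++ t :: us))

/-- A rewrite step at the root position (`→_{ε}`). -/
def RootStep (R : Set (Term F V × Term F V)) (s t : Term F V) : Prop :=
  ∃ l r σ, (l, r) ∈ R ∧ s = Term.subst σ l ∧ t = Term.subst σ r

/-- A rewrite step strictly below the root (`→_{>ε}`). -/
def BelowRew (R : Set (Term F V × Term F V)) (s t : Term F V) : Prop :=
  ∃ (f : F) (ts us : List (Term F V)) (a b : Term F V),
    Rew R a b ∧ s = .app f (ts ++ a :: us) ∧ t = .app f (ts ++ b :: us)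

/-- An innermost rewrite step strictly below the root (`i→_{>ε}`). -/
def IBelowRew (R : Set (Term F V × Term F V)) (s t : Term F V) : Prop :=
  ∃ (f : F) (ts us : List (Term F V)) (a b : Term F V),
    IRew R a b ∧ s = .app f (ts ++ a :: us) ∧ t = .app f (ts ++ b :: us)

/-- `R` is a term rewrite system: left-hand sides are not variables and
variables of right-hand sides occur in the corresponding left-hand sides. -/
def IsTRS (R : Set (Term F V × Term F V)) : Prop :=
  ∀ p ∈ R, ¬ p.1.IsVar ∧ ∀ x ∈ p.2.varOccs, x ∈ p.1.varOccs

/-- All right-hand sides are linear. -/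
def RightLinear (R : Set (Term F V × Term F V)) : Prop :=
  ∀ p ∈ R, p.2.Linear

/-- No right-hand side is a variable. -/
def NonCollapsing (R : Set (Term F V × Term F V)) : Prop :=
  ∀ p ∈ R, ¬ p.2.IsVar

/-- `R` has an inner-overlap: a proper non-variable subterm of some left-hand
side is unifiable (after renaming the rules apart, equivalently: some instance
of the one equals some instance of the other) with some left-hand side. -/
def InnerOverlap (R : Set (Term F V × Term F V)) : Prop :=
  ∃ l r l' r' u, (l, r) ∈ R ∧ (l', r') ∈ R ∧ PSub u l ∧ ¬ u.IsVar ∧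
    ∃ σ τ : V → Term F V, u.subst σ = l'.subst τ

/-- `R` is an overlay system. -/
def Overlay (R : Set (Term F V × Term F V)) : Prop := ¬ InnerOverlap R

/-- The term `t` is terminating w.r.t. `R`: no infinite rewrite sequence starts from `t`. -/
def Terminating (R : Set (Term F V × Term F V)) (t : Term F V) : Prop :=
  ¬ ∃ f : ℕ → Term F V, f 0 = t ∧ ∀ n, Rew R (f n) (f (n + 1))

/-- The TRS `R` is terminating: there is no infinite rewrite sequence. -/
def TerminatingTRS (R : Set (Term F V × Term F V)) : Prop :=
  ¬ ∃ f : ℕ → Term F V, ∀ n, Rew R (f n) (f (n + 1))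

/-- The TRS `R` is innermost terminating: there is no infinite innermost rewrite sequence. -/
def InnermostTerminatingTRS (R : Set (Term F V × Term F V)) : Prop :=
  ¬ ∃ f : ℕ → Term F V, ∀ n, IRew R (f n) (f (n + 1))

/-- Domain of a substitution. -/
def Dom (σ : V → Term F V) : Set V := {x | σ x ≠ .var x}

end RWS

namespace RWS

variable {F V : Type}

/-- Embedding of terms over the signature `F` into terms over the extended
signature `F ⊕ F`, where `Sum.inl f` is the original symbol `f` and
`Sum.inr f` is the fresh tuple symbol `f#`. -/
def Term.lift : Term F V → Term (F ⊕ F) V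
  | .var x => .var x
  | .app f ts => .app (Sum.inl f) (ts.attach.map fun t => t.1.lift)
decreasing_by
  simp_wf
  have := List.sizeOf_lt_of_mem t.2
  omega

/-- The TRS `R` viewed over the extended signature `F ⊕ F`. -/
def liftTRS (R : Set (Term F V × Term F V)) :
    Set (Term (F ⊕ F) V × Term (F ⊕ F) V) :=
  { p | ∃ l r, (l, r) ∈ R ∧ p = (l.lift, r.lift) }

/-- The defined symbols of `R`: root symbols of left-hand sides. -/
def DefinedSym (R : Set (Term F V × Term F V)) : Set F :=
  { f | ∃ ts r, (Term.app f ts, r) ∈ R }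

/-- `t#`: the term `f(t₁,…,tₙ)` with its root replaced by the tuple symbol `f#`. -/
def Term.sharp : Term F V → Term (F ⊕ F) V
  | .var x => .var x
  | .app f ts => .app (Sum.inr f) (ts.attach.map fun t => t.1.lift)

/-- The set of dependency pairs of `R`: rules `ℓ# → t#` where `ℓ → r ∈ R` and
`t` is a subterm of `r` whose root symbol is defined. -/
def DP (R : Set (Term F V × Term F V)) :
    Set (Term (F ⊕ F) V × Term (F ⊕ F) V) :=
  { p | ∃ l r t, (l, r) ∈ R ∧ Sub t r ∧
        (∃ g ts, t = Term.app g ts ∧ g ∈ DefinedSym R) ∧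
        p = (l.sharp, t.sharp) }

/-- There is an infinite minimal `(P,R)`-chain
`t₀ →_{>ε,R}* s₀ →_{ε,P} t₁ →_{>ε,R}* s₁ →_{ε,P} t₂ ⋯` (all proper subterms of
the `tᵢ` are terminating w.r.t. `R`). -/
def InfMinChain (P R : Set (Term F V × Term F V)) : Prop :=
  ∃ t s : ℕ → Term F V,
    (∀ i, Relation.ReflTransGen (BelowRew R) (t i) (s i)) ∧
    (∀ i, RootStep P (s i) (t (i + 1))) ∧
    (∀ i v, PSub v (t i) → Terminating R v)

/-- There is an infinite innermost minimal `(P,R)`-chain: as above, where the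
below-root `R`-steps are innermost and each root `P`-step is applied to a term
all of whose proper subterms are normal forms of `R`. -/
def InfInnMinChain (P R : Set (Term F V × Term F V)) : Prop :=
  ∃ t s : ℕ → Term F V,
    (∀ i, Relation.ReflTransGen (IBelowRew R) (t i) (s i)) ∧
    (∀ i v, PSub v (s i) → NormalForm R v) ∧
    (∀ i, RootStep P (s i) (t (i + 1))) ∧
    (∀ i v, PSub v (t i) → Terminating R v)

/-- Finite minimal `(P,R)`-chains of length `n` (number of root `P`-steps),
from the first term to the term reached right after the `n`-th root `P`-step. -/
inductive MinChainN (P R : Set (Term F V × Term F V)) :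
    ℕ → Term F V → Term F V → Prop
  | refl {t : Term F V} :
      (∀ v, PSub v t → Terminating R v) → MinChainN P R 0 t t
  | step {n : ℕ} {t₀ t s t' : Term F V} :
      MinChainN P R n t₀ t →
      Relation.ReflTransGen (BelowRew R) t s →
      RootStep P s t' →
      (∀ v, PSub v t' → Terminating R v) →
      MinChainN P R (n + 1) t₀ t'

/-- Finite innermost minimal `(P,R)`-chains of length `n`. -/
inductive InnMinChainN (P R : Set (Term F V × Term F V)) :
    ℕ → Term F V → Term F V → Prop
  | refl {t : Term F V} :
      (∀ v, PSub v t → Terminating R v) → InnMinChainN P R 0 t t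
  | step {n : ℕ} {t₀ t s t' : Term F V} :
      InnMinChainN P R n t₀ t →
      Relation.ReflTransGen (IBelowRew R) t s →
      (∀ v, PSub v s → NormalForm R v) →
      RootStep P s t' →
      (∀ v, PSub v t' → Terminating R v) →
      InnMinChainN P R (n + 1) t₀ t'

end RWS

namespace RWS

theorem Term.subst_app {F V : Type} (σ : V → Term F V) (f : F) (ts : List (Term F V)) :
    (Term.app f ts).subst σ = .app f (ts.map (Term.subst σ)) := by
  rw [Term.subst, List.attach_map_val (f := Term.subst σ)]

theorem Term.mem_varOccs_app {F V : Type} {x : V} {f : F} {ts : List (Term F V)} {t : Term F V}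
    (ht : t ∈ ts) (hx : x ∈ t.varOccs) : x ∈ (Term.app f ts).varOccs := by
  rw [Term.varOccs, List.attach_map_val (f := Term.varOccs)]
  exact List.mem_flatten.2 ⟨_, List.mem_map_of_mem ht, hx⟩

theorem PSub.trans {F V : Type} {s t u : Term F V} (hst : PSub s t) (htu : PSub t u) :
    PSub s u := by
  induction htu with
  | head h => exact .tail hst h
  | tail _ h ih => exact .tail ih h

theorem Rew.exists_redex {F V : Type} {R : Set (Term F V × Term F V)} {s t : Term F V}
    (h : Rew R s t) : ∃ l r σ, (l, r) ∈ R ∧ Sub (Term.subst σ l) s := by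
  induction h with
  | root h => exact ⟨_, _, _, h, .inl rfl⟩
  | congr _ ih =>
    obtain ⟨l, r, σ, hlr, rfl | hs⟩ := ih
    · exact ⟨l, r, σ, hlr, .inr (.head (by simp))⟩
    · exact ⟨l, r, σ, hlr, .inr (.tail hs (by simp))⟩

/-- Every superterm of a reducible term is reducible. -/
theorem PSub.exists_rew {F V : Type} {R : Set (Term F V × Term F V)} {s u : Term F V}
    (hsu : PSub s u) (h : ∃ t, Rew R s t) : ∃ v, Rew R u v := by
  have arg {f : F} {ts : List (Term F V)} {t : Term F V} (ht : t ∈ ts) (h : ∃ t', Rew R t t') :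
      ∃ v, Rew R (.app f ts) v := by
    obtain ⟨as, bs, rfl⟩ := List.append_of_mem ht
    obtain ⟨t', h⟩ := h
    exact ⟨_, .congr h⟩
  induction hsu with
  | head ht => exact arg ht h
  | tail _ ht ih => exact arg ht ih

/-- A proper subterm of an instance of `t` is an instance of a proper non-variable subterm
of `t`, or lies inside the image of a variable of `t`. -/
theorem PSub.of_subst {F V : Type} {σ : V → Term F V} {w : Term F V} :
    (t : Term F V) → PSub w (t.subst σ) →
      (∃ u, PSub u t ∧ ¬ u.IsVar ∧ w = u.subst σ) ∨ ∃ x ∈ t.varOccs, Sub w (σ x)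
  | .var x, h => by
    rw [Term.subst] at h
    exact .inr ⟨x, by simp [Term.varOccs], .inr h⟩
  | .app f ts, h => by
    rw [Term.subst_app] at h
    cases h with
    | head hw =>
      obtain ⟨t, ht, rfl⟩ := List.mem_map.1 hw
      by_cases hv : t.IsVar
      · cases t with
        | var x =>
          refine .inr ⟨x, Term.mem_varOccs_app ht (by simp [Term.varOccs]), .inl ?_⟩
          rw [Term.subst]
        | app => exact hv.elim
      · exact .inl ⟨t, .head ht, hv, rfl⟩
    | tail hw hu =>
      obtain ⟨t, ht, rfl⟩ := List.mem_map.1 hu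
      obtain ⟨u, hut, hv, rfl⟩ | ⟨x, hx, hs⟩ := PSub.of_subst t hw
      · exact .inl ⟨u, .tail hut ht, hv, rfl⟩
      · exact .inr ⟨x, Term.mem_varOccs_app ht hx, hs⟩
termination_by t => sizeOf t
decreasing_by
  have := List.sizeOf_lt_of_mem ht
  simp_wf
  omega

/-- If `R ∪ P` is an overlay system, `ℓ → r` is a rule of
`P`, and `xδ''` is a normal form of `R` for every variable `x ∈ Var ℓ`, then
every proper subterm of `ℓδ''` is a normal form of `R`. -/
theorem psub_of_lhs_instance_normalForm
    {F V : Type} (R P : Set (Term F V × Term F V))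
    (hR : IsTRS R) (hP : IsTRS P) (hOV : Overlay (R ∪ P))
    (l r : Term F V) (hrule : (l, r) ∈ P)
    (δ'' : V → Term F V)
    (hδ : ∀ x ∈ l.varOccs, NormalForm R (δ'' x)) :
    ∀ u, PSub u (l.subst δ'') → NormalForm R u := by
  intro u hu v huv
  obtain ⟨l', r', σ, hlr, hs⟩ := huv.exists_redex
  have hsub : PSub (l'.subst σ) (l.subst δ'') := by
    obtain hs | hs := hs
    · exact hs ▸ hu
    · exact hs.trans hu
  obtain ⟨w, hw, hv, h⟩ | ⟨x, hx, h⟩ := hsub.of_subst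
  · exact hOV ⟨l, r, l', r', w, .inr hrule, .inl hlr, hw, hv, δ'', σ, h.symm⟩
  · have hred : ∃ t, Rew R (δ'' x) t := by
      obtain h | h := h
      · exact h ▸ ⟨_, .root hlr⟩
      · exact h.exists_rew ⟨_, .root hlr⟩
    exact hred.elim (hδ x hx)

end RWS
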